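/- Location-parameter Cramér-Rao inequality: Let f be a continuously differentiable probability density on ℝⁿ vanishing at infinity (or on the boundary of its support), g a strictly positive probability density, and α, β > 1 Hölder conjugates. Then E_g[|1ᵀX|^α]^{1/α} · E_g[|1ᵀ ∇f(X)/g(X)|^β]^{1/β} ≥ n, where 1 is the all-ones vector and expectations are with respect to g. -/

import Mathlib

open MeasureTheory

/-- A `C¹` function vanishing at infinity whose derivative in the direction `(1, …, 1)` is
integrable has zero integral of that derivative. -/
theorem integral_fderiv_one_eq_zero {m : ℕ} {F : (Fin (m + 1) → ℝ) → ℝ}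
    (hF : ContDiff ℝ 1 F) (h0 : Filter.Tendsto F (Filter.cocompact _) (nhds 0))
    (h_int : Integrable fun x => fderiv ℝ F x 1) :
    ∫ x, fderiv ℝ F x 1 = 0 := by
  let line : ℝ × (Fin m → ℝ) → (Fin (m + 1) → ℝ) := fun p => Fin.cons p.1 (p.2 + p.1 • 1)
  have hshear : MeasurePreserving
      (fun p : ℝ × (Fin m → ℝ) => (p.1, p.2 + p.1 • (1 : Fin m → ℝ)))
      (volume.prod volume) (volume.prod volume) :=
    (MeasurePreserving.id volume).skew_product (g := fun t y => y + t • (1 : Fin m → ℝ))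
      (by fun_prop) (.of_forall fun t => map_add_right_eq_self volume _)
  have hline : MeasurePreserving line (volume.prod volume) volume := by
    have hline_eq : line = (MeasurableEquiv.piFinSuccAbove (fun _ : Fin (m + 1) => ℝ) 0).symm ∘
        fun p => (p.1, p.2 + p.1 • 1) := by
      ext p i
      refine Fin.cases ?_ (fun j => ?_) i <;> simp [line, MeasurableEquiv.piFinSuccAbove]
    rw [hline_eq]
    exact (volume_preserving_piFinSuccAbove (fun _ : Fin (m + 1) => ℝ) 0).symm.comp hshear
  have line_eq (t : ℝ) (y : Fin m → ℝ) :
      line (t, y) = Fin.cons 0 y + t • (1 : Fin (m + 1) → ℝ) := by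
    ext i
    refine Fin.cases ?_ (fun j => ?_) i <;> simp [line]
  have hderiv (y : Fin m → ℝ) (t : ℝ) :
      HasDerivAt (fun t => F (line (t, y))) (fderiv ℝ F (line (t, y)) 1) t := by
    have hl : HasDerivAt (fun t => line (t, y)) 1 t := by
      simp only [line_eq]
      simpa using ((hasDerivAt_id t).smul_const (1 : Fin (m + 1) → ℝ)).const_add (Fin.cons 0 y)
    exact ((hF.differentiable one_ne_zero _).hasFDerivAt).comp_hasDerivAt t hl
  have hlim (y : Fin m → ℝ) :
      Filter.Tendsto (fun t => F (line (t, y))) (Filter.cocompact ℝ) (nhds 0) := by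
    refine h0.comp (tendsto_norm_atTop_iff_cobounded.mp ?_ |>.mono_right
      Metric.cobounded_eq_cocompact.le)
    refine Filter.tendsto_atTop_mono (fun t => ?_) (tendsto_norm_cocompact_atTop (E := ℝ))
    simpa [line] using norm_le_pi_norm (line (t, y)) 0
  have h_int_line : Integrable (fun p => fderiv ℝ F (line p) 1) (volume.prod volume) :=
    hline.integrable_comp_of_integrable h_int
  have hmeas : AEStronglyMeasurable (fun x => fderiv ℝ F x 1)
      (Measure.map line (volume.prod volume)) := by
    rw [hline.map_eq]; exact h_int.aestronglyMeasurable
  rw [← hline.map_eq, integral_map hline.aemeasurable hmeas, integral_prod_symm _ h_int_line]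
  refine integral_eq_zero_of_ae ?_
  filter_upwards [h_int_line.prod_left_ae] with y hy
  simpa using integral_of_hasDerivAt_of_tendsto (hderiv y) hy
    ((hlim y).mono_left atBot_le_cocompact) ((hlim y).mono_left atTop_le_cocompact)

/-- Integration by parts for a density `f` along the direction `(1, …, 1)`. -/
theorem integral_sum_mul_sum_fderiv {n : ℕ} (hn : 0 < n) {f : (Fin n → ℝ) → ℝ}
    (hf : ContDiff ℝ 1 f) (hf_dens : ∫ x, f x = 1)
    (hxf : Filter.Tendsto (fun x => ‖x‖ * f x) (Filter.cocompact _) (nhds 0))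
    (h_int : Integrable fun x => (∑ i, x i) * ∑ i, fderiv ℝ f x (Pi.single i 1)) :
    ∫ x, (∑ i, x i) * ∑ i, fderiv ℝ f x (Pi.single i 1) = -n := by
  obtain ⟨m, rfl⟩ := Nat.exists_eq_add_one.mpr hn
  have hf_int : Integrable f := .of_integral_ne_zero (by simp [hf_dens])
  let S : (Fin (m + 1) → ℝ) →L[ℝ] ℝ := ∑ i, ContinuousLinearMap.proj i
  have hS (x) : S x = ∑ i, x i := by simp [S]
  have hfderiv (x) : fderiv ℝ (fun x => S x * f x) x 1 =
      (∑ i, x i) * (∑ i, fderiv ℝ f x (Pi.single i 1)) + (m + 1 : ℕ) * f x := by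
    have hone : (1 : Fin (m + 1) → ℝ) = ∑ i, Pi.single i 1 :=
      (Finset.univ_sum_single (1 : Fin (m + 1) → ℝ)).symm
    rw [fderiv_fun_mul S.differentiableAt (hf.differentiable one_ne_zero x), ← map_sum, ← hone]
    simp [hS, mul_comm]
  have hvanish : Filter.Tendsto (fun x => S x * f x) (Filter.cocompact _) (nhds 0) := by
    have hbound := hxf.norm.const_mul ‖S‖
    rw [norm_zero, mul_zero] at hbound
    refine squeeze_zero_norm (fun x => ?_) hbound
    rw [norm_mul, norm_mul, norm_norm, ← mul_assoc]
    gcongr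
    exact S.le_opNorm x
  have hsum := integral_fderiv_one_eq_zero (S.contDiff.mul hf) hvanish
    (by simp only [hfderiv]; exact h_int.add (hf_int.const_mul _))
  simp only [hfderiv] at hsum
  rw [integral_add h_int (hf_int.const_mul _), integral_const_mul, hf_dens, mul_one] at hsum
  exact eq_neg_of_add_eq_zero_left hsum

/-- Hölder's inequality for nonnegative functions with respect to a nonnegative weight. -/
theorem integral_mul_mul_le_rpow_mul_rpow {X : Type*} [MeasurableSpace X] {μ : Measure X}
    {p q : ℝ} (hpq : p.HolderConjugate q) {u v w : X → ℝ}
    (hu : ∀ x, 0 ≤ u x) (hv : ∀ x, 0 ≤ v x) (hw : ∀ x, 0 ≤ w x)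
    (hum : AEStronglyMeasurable u μ) (hvm : AEStronglyMeasurable v μ)
    (hwm : AEStronglyMeasurable w μ)
    (hui : Integrable (fun x => u x ^ p * w x) μ) (hvi : Integrable (fun x => v x ^ q * w x) μ) :
    ∫ x, u x * v x * w x ∂μ ≤
      (∫ x, u x ^ p * w x ∂μ) ^ (1 / p) * (∫ x, v x ^ q * w x ∂μ) ^ (1 / q) := by
  have hpow {r : ℝ} (hr : 0 < r) {h : X → ℝ} (hh : ∀ x, 0 ≤ h x) (x : X) :
      (h x * w x ^ (1 / r)) ^ r = h x ^ r * w x := by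
    rw [Real.mul_rpow (hh x) (Real.rpow_nonneg (hw x) _), ← Real.rpow_mul (hw x),
      one_div_mul_cancel hr.ne', Real.rpow_one]
  have hmem {r : ℝ} (hr : 0 < r) {h : X → ℝ} (hh : ∀ x, 0 ≤ h x)
      (hm : AEStronglyMeasurable h μ) (hi : Integrable (fun x => h x ^ r * w x) μ) :
      MemLp (fun x => h x * w x ^ (1 / r)) (ENNReal.ofReal r) μ := by
    refine (integrable_norm_rpow_iff
      (hm.mul (hwm.aemeasurable.pow_const _).aestronglyMeasurable)
      (ENNReal.ofReal_pos.mpr hr).ne' ENNReal.ofReal_ne_top).mp ?_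
    simpa only [Pi.mul_apply, ENNReal.toReal_ofReal hr.le, Real.norm_of_nonneg
      (mul_nonneg (hh _) (Real.rpow_nonneg (hw _) _)), hpow hr hh] using hi
  have holder := integral_mul_le_Lp_mul_Lq_of_nonneg hpq
    (.of_forall fun x => mul_nonneg (hu x) (Real.rpow_nonneg (hw x) (1 / p)))
    (.of_forall fun x => mul_nonneg (hv x) (Real.rpow_nonneg (hw x) (1 / q)))
    (hmem hpq.pos hu hum hui) (hmem hpq.symm.pos hv hvm hvi)
  simp only [hpow hpq.pos hu, hpow hpq.symm.pos hv] at holder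
  refine le_of_eq_of_le (integral_congr_ae (.of_forall fun x => ?_)) holder
  have hsplit : w x ^ (1 / p) * w x ^ (1 / q) = w x := by
    have hpq1 : 1 / p + 1 / q = 1 := by simpa using hpq.inv_add_inv_eq_one
    rw [← Real.rpow_add_of_nonneg (hw x) hpq.one_div_nonneg hpq.symm.one_div_nonneg, hpq1,
      Real.rpow_one]
  linear_combination (-(u x * v x)) * hsplit

/-- Location-parameter Cramér–Rao inequality:
E_g[|1ᵀX|^α]^{1/α} · E_g[|1ᵀ∇f(X)/g(X)|^β]^{1/β} ≥ n. -/
theorem location_cramer_rao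
    {n : ℕ} (hn : 0 < n)
    (f g : (Fin n → ℝ) → ℝ)
    (α β : ℝ) (hα : 1 < α) (hβ : 1 < β) (hconj : 1/α + 1/β = 1)
    (hf_smooth : ContDiff ℝ 1 f)
    (hf_nonneg : ∀ x, 0 ≤ f x)
    (hf_dens : ∫ x, f x = 1)
    (hf_vanish : Filter.Tendsto f (Filter.cocompact (Fin n → ℝ)) (nhds 0))
    (hxf_vanish : Filter.Tendsto (fun x => ‖x‖ * f x)
      (Filter.cocompact (Fin n → ℝ)) (nhds 0))
    (hg_pos : ∀ x, 0 < g x)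
    (hg_dens : ∫ x, g x = 1)
    (h_int0 : Integrable (fun x => (∑ i, x i) *
      (∑ i, fderiv ℝ f x (Pi.single i 1))))
    (h_int1 : Integrable (fun x => |∑ i, x i| ^ α * g x))
    (h_int2 : Integrable (fun x =>
      |(∑ i, fderiv ℝ f x (Pi.single i 1)) / g x| ^ β * g x)) :
    (∫ x, |∑ i, x i| ^ α * g x) ^ (1/α) *
      (∫ x, |(∑ i, fderiv ℝ f x (Pi.single i 1)) / g x| ^ β * g x) ^ (1/β)
      ≥ n := by
  have hg : Integrable g := .of_integral_ne_zero (by simp [hg_dens])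
  have hD : Continuous fun x => ∑ i, fderiv ℝ f x (Pi.single i 1) :=
    continuous_finsetSum _ fun i _ =>
      (hf_smooth.continuous_fderiv one_ne_zero).clm_apply continuous_const
  have hS : Continuous fun x : Fin n → ℝ => ∑ i, x i := by fun_prop
  have hIBP := integral_sum_mul_sum_fderiv hn hf_smooth hf_dens hxf_vanish h_int0
  have hpq : α.HolderConjugate β :=
    Real.holderConjugate_iff.mpr ⟨hα, by simpa using hconj⟩
  calc (n : ℝ) = |∫ x, (∑ i, x i) * ∑ i, fderiv ℝ f x (Pi.single i 1)| := by
        rw [hIBP, abs_neg, Nat.abs_cast]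
    _ ≤ ∫ x, |(∑ i, x i) * ∑ i, fderiv ℝ f x (Pi.single i 1)| := abs_integral_le_integral_abs
    _ = ∫ x, |∑ i, x i| * |(∑ i, fderiv ℝ f x (Pi.single i 1)) / g x| * g x := by
        congr 1 with x
        rw [abs_mul, abs_div, abs_of_pos (hg_pos x), mul_assoc, div_mul_cancel₀ _ (hg_pos x).ne']
    _ ≤ _ := integral_mul_mul_le_rpow_mul_rpow hpq (fun x => abs_nonneg _)
        (fun x => abs_nonneg _) (fun x => (hg_pos x).le)
        hS.abs.aestronglyMeasurable
        (hD.aestronglyMeasurable.aemeasurable.div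
          hg.aestronglyMeasurable.aemeasurable).abs.aestronglyMeasurable
        hg.aestronglyMeasurable h_int1 h_int2
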